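/- Let F_1, ..., F_J be production functions on ℝ_+^N, each concave and homogeneous of degree 1, and F = ⊕_{j=1}^J F_j their aggregate production function. Take any x̄ ∈ ℝ_{++}^N (strictly positive vector) and let w ∈ ℝ^N be a supergradient of F at x̄, i.e., F(x) − F(x̄) ≤ w·(x − x̄) for all x ∈ ℝ_+^N. Let x̄_1, ..., x̄_J ∈ ℝ_+^N satisfy x̄ = Σ_{j=1}^J x̄_j and F(x̄) = Σ_{j=1}^J F_j(x̄_j), and let C = cone({x̄_1, ..., x̄_J}) be the smallest convex cone containing {x̄_1, ..., x̄_J}. Then F(x) = w·x for all x ∈ C. -/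

import Mathlib

/-- `G` is the aggregate production function `⊕ⱼ F j` of the production functions `F j`. -/
def IsAggregate {N J : ℕ} (F : Fin J → (Fin N → ℝ) → ℝ) (G : (Fin N → ℝ) → ℝ) : Prop :=
  ∀ x : Fin N → ℝ, 0 ≤ x →
    IsGreatest {s : ℝ | ∃ xs : Fin J → (Fin N → ℝ),
      (∀ j, 0 ≤ xs j) ∧ (∑ j, xs j) = x ∧ s = ∑ j, F j (xs j)} (G x)

/-- `C` is the smallest convex cone containing `S`. -/
def IsSmallestConvexCone {N : ℕ} (S C : Set (Fin N → ℝ)) : Prop :=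
  Convex ℝ C ∧ (∀ y ∈ C, ∀ α : ℝ, 0 ≤ α → α • y ∈ C) ∧ S ⊆ C ∧
    ∀ D : Set (Fin N → ℝ), Convex ℝ D → (∀ y ∈ D, ∀ α : ℝ, 0 ≤ α → α • y ∈ D) →
      S ⊆ D → C ⊆ D

/-- Scaling each summand of an allocation by a nonnegative factor gives a feasible allocation, so
the aggregate of homogeneous production functions dominates the scaled outputs. -/
theorem IsAggregate.sum_mul_le {N J : ℕ} {F : Fin J → (Fin N → ℝ) → ℝ} {G : (Fin N → ℝ) → ℝ}
    (hG : IsAggregate F G)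
    (hF_hom : ∀ j, ∀ c : ℝ, 0 ≤ c → ∀ x : Fin N → ℝ, 0 ≤ x → F j (c • x) = c * F j x)
    {xs : Fin J → (Fin N → ℝ)} (hxs : ∀ j, 0 ≤ xs j) {a : Fin J → ℝ} (ha : ∀ j, 0 ≤ a j) :
    ∑ j, a j * F j (xs j) ≤ G (∑ j, a j • xs j) := by
  have hax : ∀ j, 0 ≤ a j • xs j := fun j => smul_nonneg (ha j) (hxs j)
  refine (hG _ (Finset.sum_nonneg fun j _ => hax j)).2 ⟨fun j => a j • xs j, hax, rfl, ?_⟩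
  exact Finset.sum_congr rfl fun j _ => (hF_hom j _ (ha j) _ (hxs j)).symm

/-- The smallest convex cone containing a finite family consists of nonnegative combinations. -/
theorem IsSmallestConvexCone.exists_eq_sum {N J : ℕ} {xs : Fin J → (Fin N → ℝ)}
    {C : Set (Fin N → ℝ)} (hC : IsSmallestConvexCone (Set.range xs) C) {x : Fin N → ℝ}
    (hx : x ∈ C) : ∃ a : Fin J → ℝ, (∀ j, 0 ≤ a j) ∧ x = ∑ j, a j • xs j := by
  refine hC.2.2.2 {x | ∃ a : Fin J → ℝ, (∀ j, 0 ≤ a j) ∧ x = ∑ j, a j • xs j} ?_ ?_ ?_ hx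
  · rintro _ ⟨a, ha, rfl⟩ _ ⟨b, hb, rfl⟩ s t hs ht _
    refine ⟨fun j => s * a j + t * b j,
      fun j => add_nonneg (mul_nonneg hs (ha j)) (mul_nonneg ht (hb j)), ?_⟩
    simp only [Finset.smul_sum, add_smul, mul_smul, Finset.sum_add_distrib]
  · rintro _ ⟨a, ha, rfl⟩ s hs
    exact ⟨fun j => s * a j, fun j => mul_nonneg hs (ha j), by
      simp only [Finset.smul_sum, mul_smul]⟩
  · rintro _ ⟨j, rfl⟩
    refine ⟨Pi.single j 1, fun k => ?_, ?_⟩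
    · by_cases h : k = j
      · subst h; simp
      · simp [h]
    · simp [Pi.single_apply, ite_smul]

/-- Linearity of the aggregate production function, output maximization:
for concave homogeneous production functions, if `x̄ ≫ 0`, `w` is a supergradient of the
aggregate production function `G` at `x̄`, `x̄ = ∑ⱼ x̄ⱼ` with `G x̄ = ∑ⱼ F j x̄ⱼ`, and `C`
is the smallest convex cone containing `{x̄ 1, …, x̄ J}`, then `G x = w·x` on `C`. -/
theorem aggregate_linear_output_maximization
    {N J : ℕ} (F : Fin J → (Fin N → ℝ) → ℝ)
    (hF_nonneg : ∀ j, ∀ x : Fin N → ℝ, 0 ≤ x → 0 ≤ F j x)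
    (hF_usc : ∀ j, UpperSemicontinuousOn (F j) {x : Fin N → ℝ | 0 ≤ x})
    (hF_concave : ∀ j, ConcaveOn ℝ {x : Fin N → ℝ | 0 ≤ x} (F j))
    (hF_hom : ∀ j, ∀ c : ℝ, 0 ≤ c → ∀ x : Fin N → ℝ, 0 ≤ x → F j (c • x) = c * F j x)
    (G : (Fin N → ℝ) → ℝ) (hG : IsAggregate F G)
    (xbar : Fin N → ℝ) (hxbar : ∀ i, 0 < xbar i)
    (w : Fin N → ℝ)
    (hw : ∀ x : Fin N → ℝ, 0 ≤ x → G x - G xbar ≤ ∑ i, w i * (x i - xbar i))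
    (xs : Fin J → (Fin N → ℝ)) (hxs_nonneg : ∀ j, 0 ≤ xs j)
    (hxs_sum : (∑ j, xs j) = xbar) (hxs_opt : G xbar = ∑ j, F j (xs j))
    (C : Set (Fin N → ℝ)) (hC : IsSmallestConvexCone (Set.range xs) C) :
    ∀ x ∈ C, G x = ∑ i, w i * x i := by
  have hw' : ∀ x : Fin N → ℝ, 0 ≤ x → G x - G xbar ≤ w ⬝ᵥ x - w ⬝ᵥ xbar := fun x hx => by
    rw [← dotProduct_sub]
    exact hw x hx
  have hsum_nonneg : ∀ a : Fin J → ℝ, (∀ j, 0 ≤ a j) → 0 ≤ ∑ j, a j • xs j := fun a ha =>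
    Finset.sum_nonneg fun j _ => smul_nonneg (ha j) (hxs_nonneg j)
  have hdot : ∀ a : Fin J → ℝ, w ⬝ᵥ (∑ j, a j • xs j) = ∑ j, a j * (w ⬝ᵥ xs j) := fun a => by
    simp only [dotProduct_sum, dotProduct_smul, smul_eq_mul]
  have hxbar_dot : w ⬝ᵥ xbar = ∑ j, w ⬝ᵥ xs j := by rw [← hxs_sum, dotProduct_sum]
  have hprofit : ∀ a : Fin J → ℝ, (∀ j, 0 ≤ a j) →
      ∑ j, (a j - 1) * (F j (xs j) - w ⬝ᵥ xs j) ≤ 0 := fun a ha => by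
    have h₁ := hG.sum_mul_le hF_hom hxs_nonneg ha
    have h₂ := hw' _ (hsum_nonneg a ha)
    rw [hdot, hxbar_dot, hxs_opt] at h₂
    simp only [mul_sub, sub_mul, one_mul, Finset.sum_sub_distrib]
    linarith
  have hzero : ∀ j, F j (xs j) = w ⬝ᵥ xs j := fun j => by
    have h : ∀ t : ℝ, 0 ≤ t → (t - 1) * (F j (xs j) - w ⬝ᵥ xs j) ≤ 0 := fun t ht => by
      have h' := hprofit (Function.update 1 j t) fun k => by
        by_cases hk : k = j
        · subst hk; simpa using ht
        · simp [hk]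
      rw [Finset.sum_eq_single j (fun k _ hk => by simp [hk]) (by simp)] at h'
      simpa using h'
    linarith [h 0 le_rfl, h 2 zero_le_two]
  intro x hx
  change G x = w ⬝ᵥ x
  obtain ⟨a, ha, rfl⟩ := hC.exists_eq_sum hx
  have h₁ := hG.sum_mul_le hF_hom hxs_nonneg ha
  have h₂ := hw' _ (hsum_nonneg a ha)
  simp only [hzero, ← hdot] at h₁
  simp only [hxs_opt, hzero, ← hxbar_dot] at h₂
  linarith
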